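/- arXiv:1508.07729 — 2 statements merged into one kernel-verified Lean document; each statement's English description precedes it below -/
import Mathlib

section
/- (Proposition 2) If the marginal cost c is positive (a > c > 0) and γ ∈ [0, π/4], then the set N of Nash equilibria of the quantum Cournot duopoly defined by the author's measurement-based scheme is: N = {((a−c)·cos²γ/(2cos²γ + 1), (a−c)·cos²γ/(2cos²γ + 1))} if γ ≠ π/4, and N = {(x, (a−c)/2 − x) : x ∈ [0, (a−c)/2]} if γ = π/4. -/
/-- Player 1's payoff in the measurement-based quantum Cournot duopoly. -/
noncomputable def uQ1 (a c γ x1 x2 : ℝ) : ℝ :=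
  if x1 + x2 ≤ a then
    (x1 * Real.cos γ ^ 2 + x2 * Real.sin γ ^ 2) * (a - c - x1 - x2)
  else -c * (x1 * Real.cos γ ^ 2 + x2 * Real.sin γ ^ 2)

/-- Player 2's payoff in the measurement-based quantum Cournot duopoly. -/
noncomputable def uQ2 (a c γ x1 x2 : ℝ) : ℝ :=
  if x1 + x2 ≤ a then
    (x2 * Real.cos γ ^ 2 + x1 * Real.sin γ ^ 2) * (a - c - x1 - x2)
  else -c * (x2 * Real.cos γ ^ 2 + x1 * Real.sin γ ^ 2)

theorem uQ2_eq_uQ1_swap (a c γ x1 x2 : ℝ) : uQ2 a c γ x1 x2 = uQ1 a c γ x2 x1 := by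
  unfold uQ1 uQ2
  rw [add_comm x1 x2, sub_right_comm]

/-- Player 1's candidate best response to `y`: the maximizer on `[0, ∞)` of the quadratic branch
of the payoff. -/
noncomputable def bestResponse (a c γ y : ℝ) : ℝ :=
  max 0 (((a - c) * Real.cos γ ^ 2 - y) / (2 * Real.cos γ ^ 2))

theorem uQ1_lt_bestResponse {a c γ y t : ℝ} (hc : 0 < c)
    (hC : 0 < Real.cos γ ^ 2) (hy : 0 ≤ y) (ht : 0 ≤ t) (hne : t ≠ bestResponse a c γ y) :
    uQ1 a c γ t y < uQ1 a c γ (bestResponse a c γ y) y := by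
  unfold bestResponse at hne ⊢
  unfold uQ1
  have hS : Real.sin γ ^ 2 = 1 - Real.cos γ ^ 2 := Real.sin_sq γ
  have hS0 : 0 ≤ Real.sin γ ^ 2 := sq_nonneg _
  rw [hS] at hS0 ⊢
  generalize Real.cos γ ^ 2 = C at *
  have hSy : 0 ≤ (1 - C) * y := mul_nonneg hS0 hy
  rcases le_total ((a - c) * C - y) 0 with hk | hk
  · rw [max_eq_left (div_nonpos_of_nonpos_of_nonneg hk (by positivity))] at hne ⊢
    have ht' : 0 < t := lt_of_le_of_ne ht hne.symm
    have hCt : 0 < C * t := mul_pos hC ht'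
    split_ifs with h1 h2 h2
    · nlinarith [mul_nonneg ht (neg_nonneg.2 hk), mul_pos hCt ht']
    · linarith
    · nlinarith [mul_nonneg hSy (by linarith : 0 ≤ a - y), mul_pos hc hCt]
    · nlinarith [mul_pos hc hCt]
  · rw [max_eq_right (div_nonneg hk (by positivity))] at hne ⊢
    set b := ((a - c) * C - y) / (2 * C) with hb
    have hbC : 2 * C * b = (a - c) * C - y := by rw [hb]; field_simp
    have hb0 : 0 ≤ b := div_nonneg hk (by positivity)
    have hby : 2 * b ≤ a - c - y := by
      refine le_of_mul_le_mul_left ?_ hC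
      linarith
    rw [if_pos (by linarith : b + y ≤ a)]
    split_ifs with h1
    · have : 0 < C * (t - b) ^ 2 := mul_pos hC (sq_pos_of_ne_zero (sub_ne_zero.2 hne))
      have key : (b * C + y * (1 - C)) * (a - c - b - y) - (t * C + y * (1 - C)) * (a - c - t - y)
          = C * (t - b) ^ 2 := by
        linear_combination (t - b) * hbC
      linarith
    · have ht' : 0 < t := by linarith
      have h2 : 0 < c * (t * C + y * (1 - C)) :=
        mul_pos hc (by linarith [mul_pos ht' hC])
      have h3 : 0 ≤ (b * C + y * (1 - C)) * (a - c - b - y) :=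
        mul_nonneg (by linarith [mul_nonneg hb0 hC.le]) (by linarith)
      linarith

theorem forall_uQ1_le_iff {a c γ x y : ℝ} (hc : 0 < c)
    (hC : 0 < Real.cos γ ^ 2) (hx : 0 ≤ x) (hy : 0 ≤ y) :
    (∀ t : ℝ, 0 ≤ t → uQ1 a c γ t y ≤ uQ1 a c γ x y) ↔ x = bestResponse a c γ y := by
  constructor
  · intro h
    by_contra hne
    exact (uQ1_lt_bestResponse hc hC hy hx hne).not_ge (h _ (le_max_left _ _))
  · rintro rfl t ht
    rcases eq_or_ne t (bestResponse a c γ y) with h | h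
    · rw [h]
    · exact (uQ1_lt_bestResponse hc hC hy ht h).le

theorem eq_bestResponse_iff {a c γ x y : ℝ} (hC : 0 < Real.cos γ ^ 2) :
    x = bestResponse a c γ y ↔
      x = 0 ∧ (a - c) * Real.cos γ ^ 2 ≤ y ∨
        0 ≤ x ∧ 2 * Real.cos γ ^ 2 * x = (a - c) * Real.cos γ ^ 2 - y := by
  unfold bestResponse
  generalize Real.cos γ ^ 2 = C at *
  have h2C : 0 < 2 * C := by positivity
  constructor
  · rintro rfl
    rcases le_total (((a - c) * C - y) / (2 * C)) 0 with h | h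
    · rw [max_eq_left h]
      rw [div_le_iff₀ h2C] at h
      exact Or.inl ⟨rfl, by linarith⟩
    · rw [max_eq_right h]
      exact Or.inr ⟨h, by field_simp⟩
  · rintro (⟨rfl, h⟩ | ⟨hx, h⟩)
    · exact (max_eq_left (div_nonpos_of_nonpos_of_nonneg (by linarith) h2C.le)).symm
    · rw [← h, mul_div_cancel_left₀ _ h2C.ne', max_eq_right hx]

theorem nash_iff {a c γ x y : ℝ} (hc : 0 < c) (hC : 0 < Real.cos γ ^ 2) :
    (0 ≤ x ∧ 0 ≤ y ∧ (∀ x1 : ℝ, 0 ≤ x1 → uQ1 a c γ x1 y ≤ uQ1 a c γ x y) ∧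
        (∀ x2 : ℝ, 0 ≤ x2 → uQ2 a c γ x x2 ≤ uQ2 a c γ x y)) ↔
      x = bestResponse a c γ y ∧ y = bestResponse a c γ x := by
  simp only [uQ2_eq_uQ1_swap]
  constructor
  · rintro ⟨hx, hy, h1, h2⟩
    exact ⟨(forall_uQ1_le_iff hc hC hx hy).1 h1, (forall_uQ1_le_iff hc hC hy hx).1 h2⟩
  · rintro ⟨h1, h2⟩
    have hx : 0 ≤ x := h1 ▸ le_max_left _ _
    have hy : 0 ≤ y := h2 ▸ le_max_left _ _
    exact ⟨hx, hy, (forall_uQ1_le_iff hc hC hx hy).2 h1,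
      (forall_uQ1_le_iff hc hC hy hx).2 h2⟩

theorem cos_pi_div_four_sq : Real.cos (Real.pi / 4) ^ 2 = 1 / 2 := by
  rw [Real.cos_pi_div_four, div_pow, Real.sq_sqrt zero_le_two]
  norm_num

/-- (Proposition 2) For positive marginal cost and `γ ∈ [0, π/4]`, the set of Nash
equilibria of the measurement-based quantum Cournot duopoly is the singleton
`{(v, v)}` with `v = (a-c)·cos²γ/(2cos²γ + 1)` when `γ ≠ π/4`, and the segment
`{(x, (a-c)/2 - x) : x ∈ [0, (a-c)/2]}` when `γ = π/4`. -/
theorem measurement_scheme_equilibria (a c γ : ℝ) (hc : 0 < c) (hca : c < a)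
    (hγ0 : 0 ≤ γ) (hγ1 : γ ≤ Real.pi / 4) :
    (γ ≠ Real.pi / 4 →
      {p : ℝ × ℝ | 0 ≤ p.1 ∧ 0 ≤ p.2 ∧
          (∀ x1 : ℝ, 0 ≤ x1 → uQ1 a c γ x1 p.2 ≤ uQ1 a c γ p.1 p.2) ∧
          (∀ x2 : ℝ, 0 ≤ x2 → uQ2 a c γ p.1 x2 ≤ uQ2 a c γ p.1 p.2)} =
        {((a - c) * Real.cos γ ^ 2 / (2 * Real.cos γ ^ 2 + 1),
          (a - c) * Real.cos γ ^ 2 / (2 * Real.cos γ ^ 2 + 1))}) ∧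
    (γ = Real.pi / 4 →
      {p : ℝ × ℝ | 0 ≤ p.1 ∧ 0 ≤ p.2 ∧
          (∀ x1 : ℝ, 0 ≤ x1 → uQ1 a c γ x1 p.2 ≤ uQ1 a c γ p.1 p.2) ∧
          (∀ x2 : ℝ, 0 ≤ x2 → uQ2 a c γ p.1 x2 ≤ uQ2 a c γ p.1 p.2)} =
        {p : ℝ × ℝ | ∃ x ∈ Set.Icc 0 ((a - c) / 2), p = (x, (a - c) / 2 - x)}) := by
  have hm : 0 < a - c := sub_pos.2 hca
  constructor
  · intro hne
    have hC : 1 / 2 < Real.cos γ ^ 2 := by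
      have h4 : 0 < Real.cos (Real.pi / 4) := by rw [Real.cos_pi_div_four]; positivity
      have hlt : Real.cos (Real.pi / 4) < Real.cos γ :=
        Real.cos_lt_cos_of_nonneg_of_le_pi hγ0 (by linarith [Real.pi_pos])
          (lt_of_le_of_ne hγ1 hne)
      rw [← cos_pi_div_four_sq]
      exact pow_lt_pow_left₀ hlt h4.le two_ne_zero
    have hC0 : 0 < Real.cos γ ^ 2 := by linarith
    ext ⟨x, y⟩
    simp only [Set.mem_ofPred_eq, Set.mem_singleton_iff, Prod.mk.injEq]
    rw [nash_iff hc hC0, eq_bestResponse_iff hC0, eq_bestResponse_iff hC0]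
    generalize Real.cos γ ^ 2 = C at *
    have hden : 0 < 2 * C + 1 := by linarith
    rw [eq_div_iff hden.ne', eq_div_iff hden.ne']
    have hmC : 0 < (a - c) * C := mul_pos hm hC0
    have hgap : 0 < (a - c) * C * (2 * C - 1) := mul_pos hmC (by linarith)
    constructor
    · rintro ⟨⟨rfl, h1⟩ | ⟨hx, h1⟩, ⟨rfl, h2⟩ | ⟨hy, h2⟩⟩
      · linarith
      · nlinarith
      · nlinarith
      · have hxy : x = y := by
          have : (2 * C - 1) * (x - y) = 0 := by linear_combination h1 - h2
          rcases mul_eq_zero.1 this with h | h <;> linarith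
        subst hxy
        constructor <;> linarith
    · rintro ⟨h1, h2⟩
      have hxy : x = y := mul_right_cancel₀ hden.ne' (h1.trans h2.symm)
      subst hxy
      have hx : 0 ≤ x := by
        by_contra! hx
        linarith [mul_neg_of_neg_of_pos hx hden]
      exact ⟨Or.inr ⟨hx, by linarith⟩, Or.inr ⟨hx, by linarith⟩⟩
  · rintro rfl
    have hC0 : 0 < Real.cos (Real.pi / 4) ^ 2 := by rw [cos_pi_div_four_sq]; norm_num
    ext ⟨x, y⟩
    simp only [Set.mem_ofPred_eq, Set.mem_Icc, Prod.mk.injEq]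
    rw [nash_iff hc hC0, eq_bestResponse_iff hC0, eq_bestResponse_iff hC0,
      cos_pi_div_four_sq]
    constructor
    · intro h
      refine ⟨x, ?_, rfl, ?_⟩
      · rcases h with ⟨⟨h0, h1⟩ | ⟨h0, h1⟩, ⟨h2, h3⟩ | ⟨h2, h3⟩⟩ <;> constructor <;> linarith
      · rcases h with ⟨⟨h0, h1⟩ | ⟨h0, h1⟩, ⟨h2, h3⟩ | ⟨h2, h3⟩⟩ <;> linarith
    · rintro ⟨_, ⟨h0, h1⟩, rfl, rfl⟩
      exact ⟨Or.inr ⟨h0, by ring⟩, Or.inr ⟨by linarith, by ring⟩⟩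
end

section
/- In the measurement-based quantum Cournot duopoly with a > c > 0 and γ ∈ [0, π/4], for every fixed x2 ∈ [0,∞) the set of maximizers of x1 ↦ u^Q_1(x1, x2) over [0,∞) is the singleton {((a−c)·cos²γ − x2)/(2cos²γ)} if 0 ≤ x2 ≤ (a−c)·cos²γ, and the singleton {0} if x2 > (a−c)·cos²γ. -/
/-- A strict maximizer on `[0,∞)` is the only maximizer there. -/
theorem setOf_isMax_eq_singleton_of_lt {f : ℝ → ℝ} {t : ℝ} (ht : 0 ≤ t)
    (h : ∀ y : ℝ, 0 ≤ y → y ≠ t → f y < f t) :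
    {x : ℝ | 0 ≤ x ∧ ∀ y : ℝ, 0 ≤ y → f y ≤ f x} = {t} := by
  ext x
  simp only [Set.mem_ofPred_eq, Set.mem_singleton_iff]
  constructor
  · rintro ⟨hx, hmax⟩
    by_contra hne
    exact absurd (hmax t ht) (not_le.mpr (h x hx hne))
  · rintro rfl
    refine ⟨ht, fun y hy => ?_⟩
    rcases eq_or_ne y x with rfl | hne
    · exact le_rfl
    · exact (h y hy hne).le

/-- Player 1's best reply in the measurement-based quantum Cournot duopoly: for fixed
`x2 ≥ 0`, the set of maximizers of `x1 ↦ uQ1 x1 x2` over `[0,∞)` is the singleton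
`{((a-c)·cos²γ - x2)/(2cos²γ)}` if `x2 ≤ (a-c)·cos²γ`, and `{0}` otherwise. -/
theorem measurement_scheme_best_reply (a c γ : ℝ) (hc : 0 < c) (hca : c < a)
    (hγ0 : 0 ≤ γ) (hγ1 : γ ≤ Real.pi / 4) (x2 : ℝ) (hx2 : 0 ≤ x2) :
    (x2 ≤ (a - c) * Real.cos γ ^ 2 →
      {x1 : ℝ | 0 ≤ x1 ∧ ∀ y : ℝ, 0 ≤ y → uQ1 a c γ y x2 ≤ uQ1 a c γ x1 x2} =
        {((a - c) * Real.cos γ ^ 2 - x2) / (2 * Real.cos γ ^ 2)}) ∧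
    ((a - c) * Real.cos γ ^ 2 < x2 →
      {x1 : ℝ | 0 ≤ x1 ∧ ∀ y : ℝ, 0 ≤ y → uQ1 a c γ y x2 ≤ uQ1 a c γ x1 x2} = {0}) := by
  have hC : 0 < Real.cos γ ^ 2 := by
    have : 0 < Real.cos γ := Real.cos_pos_of_mem_Ioo
      ⟨by linarith [Real.pi_pos], by linarith [Real.pi_pos]⟩
    positivity
  have hS : 0 ≤ Real.sin γ ^ 2 := sq_nonneg _
  have hSC : Real.sin γ ^ 2 = 1 - Real.cos γ ^ 2 := Real.sin_sq γ
  constructor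
  · intro hx
    refine setOf_isMax_eq_singleton_of_lt (f := fun y => uQ1 a c γ y x2)
      (div_nonneg (by linarith) (by linarith)) ?_
    intro y hy hne
    obtain ⟨t, ht⟩ : ∃ t, t = ((a - c) * Real.cos γ ^ 2 - x2) / (2 * Real.cos γ ^ 2) := ⟨_, rfl⟩
    have ht0 : 0 ≤ t := ht ▸ div_nonneg (by linarith) (by linarith)
    rw [← ht] at hne ⊢
    have htC : 2 * (t * Real.cos γ ^ 2) = (a - c) * Real.cos γ ^ 2 - x2 := by
      rw [ht, ← mul_assoc, mul_comm 2, mul_assoc, div_mul_cancel₀ _ (by positivity)]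
    simp only [uQ1]
    generalize Real.cos γ ^ 2 = C at *
    generalize Real.sin γ ^ 2 = S at *
    subst hSC
    have hxm : x2 ≤ a - c := by nlinarith
    have htm : t + x2 ≤ a - c := by
      have : 0 ≤ C * (a - c - x2 - t) := by nlinarith
      linarith [nonneg_of_mul_nonneg_right this hC]
    rw [if_pos (by linarith : t + x2 ≤ a)]
    split_ifs with hya
    · have hsq : 0 < C * (y - t) ^ 2 := mul_pos hC (sq_pos_of_ne_zero (sub_ne_zero.mpr hne))
      linear_combination hsq + (t - y) * htC
    · have h1 : 0 ≤ (t * C + x2 * (1 - C)) * (a - c - t - x2) :=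
        mul_nonneg (add_nonneg (mul_nonneg ht0 hC.le) (mul_nonneg hx2 hS)) (by linarith)
      have h2 : 0 < c * (y * C + x2 * (1 - C)) :=
        mul_pos hc (add_pos_of_pos_of_nonneg (mul_pos (by linarith) hC) (mul_nonneg hx2 hS))
      linarith
  · intro hx
    refine setOf_isMax_eq_singleton_of_lt (f := fun y => uQ1 a c γ y x2) le_rfl ?_
    intro y hy hne
    have hy0 : 0 < y := lt_of_le_of_ne hy hne.symm
    simp only [uQ1]
    generalize Real.cos γ ^ 2 = C at *
    generalize Real.sin γ ^ 2 = S at *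
    subst hSC
    have hcyC : 0 < c * (y * C) := by positivity
    split_ifs with h1 h2 h2
    · have : 0 < y * (C * y + x2 - (a - c) * C) :=
        mul_pos hy0 (by linarith [mul_pos hC hy0])
      linarith
    · linarith
    · have : 0 ≤ (x2 * (1 - C)) * (a - x2) := mul_nonneg (mul_nonneg hx2 hS) (by linarith)
      linarith
    · linarith
end
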